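/- Let X and Y be real Banach spaces. Assume there exists a normalized weakly null sequence (x_n) in X admitting a spreading model (e_n) in a Banach space (S, ‖·‖_S) which is equivalent to the unit vector basis of c_0, i.e. there exist A, B > 0 such that A·max_{1≤i≤k} |a_i| ≤ ‖Σ_{i=1}^k a_i e_i‖_S ≤ B·max_{1≤i≤k} |a_i| for all k ∈ ℕ and all reals a_1, …, a_k. Assume further that there exists a map f : X → Y which is weakly sequentially continuous, coarse, and satisfies Property (*). Then Y is not AUCable: for every function N : Y → ℝ which is a norm on Y (N(y) = 0 if and only if y = 0, N(a·y) = |a|·N(y), N(y + z) ≤ N(y) + N(z)) and is equivalent to the original norm (there exist a, b > 0 with a·‖y‖ ≤ N(y) ≤ b·‖y‖ for all y ∈ Y), there exists t > 0 such that inf_{x ∈ Y, N(x) = 1} sup_E inf_{y ∈ E, N(y) = 1} (N(x + t y) − 1) ≤ 0, where the supremum runs over all closed linear subspaces E of Y of finite codimension. -/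

import Mathlib

open Filter

/-- A map between normed spaces is *coarse* if points at distance at most `t`
are mapped to points at uniformly bounded distance. -/
def Coarse {X Y : Type*} [NormedAddCommGroup X] [NormedAddCommGroup Y]
    (f : X → Y) : Prop :=
  ∀ t : ℝ, 0 ≤ t → ∃ C : ℝ, ∀ x y : X, ‖x - y‖ ≤ t → ‖f x - f y‖ ≤ C

/-- Property (*): there are `0 < α < β` and `b > 0` such that points at distance
in `[α, β]` are mapped to points at distance at least `b`. -/
def PropertyStar {X Y : Type*} [NormedAddCommGroup X] [NormedAddCommGroup Y]
    (f : X → Y) : Prop :=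
  ∃ α β b : ℝ, 0 < α ∧ α < β ∧ 0 < b ∧
    ∀ x y : X, α ≤ ‖x - y‖ → ‖x - y‖ ≤ β → b ≤ ‖f x - f y‖

/-- A map is weakly sequentially continuous if it sends weakly convergent
sequences to weakly convergent sequences. -/
def WeakSeqCont {X Y : Type*} [NormedAddCommGroup X] [NormedSpace ℝ X]
    [NormedAddCommGroup Y] [NormedSpace ℝ Y] (f : X → Y) : Prop :=
  ∀ (x : ℕ → X) (x₀ : X),
    (∀ φ : X →L[ℝ] ℝ, Tendsto (fun n => φ (x n)) atTop (nhds (φ x₀))) →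
    ∀ ψ : Y →L[ℝ] ℝ, Tendsto (fun n => ψ (f (x n))) atTop (nhds (ψ (f x₀)))

/-- The modulus of asymptotic uniform convexity `δ̄_Y(t)`. -/
noncomputable def AUCmod (Y : Type*) [NormedAddCommGroup Y] [NormedSpace ℝ Y] (t : ℝ) : ℝ :=
  sInf { r : ℝ | ∃ x : Y, ‖x‖ = 1 ∧
    r = sSup { s : ℝ | ∃ E : Subspace ℝ Y, IsClosed (E : Set Y) ∧
      FiniteDimensional ℝ (Y ⧸ E) ∧
      s = sInf { u : ℝ | ∃ y : Y, y ∈ E ∧ ‖y‖ = 1 ∧ u = ‖x + t • y‖ - 1 } } }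

/-- `(e_n)` in `S` is a spreading model of the bounded sequence `(x_n)` in `X`. -/
def IsSpreadingModel {X S : Type*} [NormedAddCommGroup X] [NormedSpace ℝ X]
    [NormedAddCommGroup S] [NormedSpace ℝ S] (x : ℕ → X) (e : ℕ → S) : Prop :=
  ∀ ε : ℝ, 0 < ε → ∀ k : ℕ, ∃ ℓ : ℕ, ∀ n : Fin k → ℕ,
    StrictMono n → (∀ i, ℓ ≤ n i) → ∀ a : Fin k → ℝ, (∀ i, |a i| ≤ 1) →
      |‖∑ i, a i • x (n i)‖ - ‖∑ i, a i • e (i : ℕ)‖| ≤ ε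

/-- A closed finite-codimensional subspace asymptotically contains every weakly null sequence. -/
lemma eventually_exists_mem_norm_sub_lt {Y : Type*} [NormedAddCommGroup Y] [NormedSpace ℝ Y]
    (E : Subspace ℝ Y) (hE : IsClosed (E : Set Y)) (hfin : FiniteDimensional ℝ (Y ⧸ E))
    (v : ℕ → Y) (hv : ∀ φ : Y →L[ℝ] ℝ, Tendsto (fun n => φ (v n)) atTop (nhds 0))
    (η : ℝ) (hη : 0 < η) :
    ∀ᶠ n in atTop, ∃ z ∈ E, ‖v n - z‖ < η := by
  have : IsClosed (E : Set Y) := hE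
  let T : (Y ⧸ E) ≃L[ℝ] (Fin (Module.finrank ℝ (Y ⧸ E)) → ℝ) :=
    (Module.finBasis ℝ (Y ⧸ E)).equivFunL
  let q : Y →L[ℝ] Y ⧸ E := E.mkQL
  have hT : Tendsto (fun n => T (q (v n))) atTop (nhds 0) := by
    rw [tendsto_pi_nhds]
    intro i
    exact hv ((ContinuousLinearMap.proj i).comp (T.toContinuousLinearMap.comp q))
  have hq : Tendsto (fun n => q (v n)) atTop (nhds 0) := by
    have := (T.symm.continuous.tendsto 0).comp hT
    simpa [Function.comp_def] using this
  have hlt := (tendsto_norm_zero.comp hq).eventually_lt_const hη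
  filter_upwards [hlt] with n hn
  obtain ⟨m, hm, hmn⟩ := (QuotientAddGroup.norm_lt_iff (S := E.toAddSubgroup)).1 hn
  refine ⟨v n - m, ?_, by simpa using hmn⟩
  have : (Submodule.Quotient.mk m : Y ⧸ E) = Submodule.Quotient.mk (v n) := hm
  exact (Submodule.Quotient.eq E).1 this.symm

/-- If the modulus of asymptotic uniform convexity of `N` at `t` is positive, some closed
finite-codimensional subspace witnesses it at each point of the unit sphere, uniformly. -/
lemma exists_subspace_of_modulus_pos {Y : Type*} [NormedAddCommGroup Y] [NormedSpace ℝ Y]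
    (N : Y → ℝ) (t : ℝ)
    (h : 0 < sInf { r : ℝ | ∃ x₀ : Y, N x₀ = 1 ∧
          r = sSup { s : ℝ | ∃ E : Subspace ℝ Y, IsClosed (E : Set Y) ∧
            FiniteDimensional ℝ (Y ⧸ E) ∧
            s = sInf { u : ℝ | ∃ y : Y, y ∈ E ∧ N y = 1 ∧ u = N (x₀ + t • y) - 1 } } }) :
    ∃ δ : ℝ, 0 < δ ∧ ∀ x₀ : Y, N x₀ = 1 → ∃ E : Subspace ℝ Y, IsClosed (E : Set Y) ∧
      FiniteDimensional ℝ (Y ⧸ E) ∧ ∀ y ∈ E, N y = 1 → 1 + δ ≤ N (x₀ + t • y) := by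
  set R := { r : ℝ | ∃ x₀ : Y, N x₀ = 1 ∧
          r = sSup { s : ℝ | ∃ E : Subspace ℝ Y, IsClosed (E : Set Y) ∧
            FiniteDimensional ℝ (Y ⧸ E) ∧
            s = sInf { u : ℝ | ∃ y : Y, y ∈ E ∧ N y = 1 ∧ u = N (x₀ + t • y) - 1 } } } with hR
  refine ⟨sInf R / 2, by positivity, fun x₀ hx₀ => ?_⟩
  have hbdd : BddBelow R := by
    by_contra hb
    rw [Real.sInf_of_not_bddBelow hb] at h
    exact lt_irrefl _ h
  have hle := csInf_le hbdd (show _ ∈ R from ⟨x₀, hx₀, rfl⟩)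
  have hlt := lt_of_lt_of_le (half_lt_self h) hle
  obtain ⟨s, ⟨E, hE, hfin, rfl⟩, hs⟩ := exists_lt_of_lt_csSup (by
    by_contra hne
    rw [Set.not_nonempty_iff_eq_empty] at hne
    rw [hne, Real.sSup_empty] at hlt
    linarith) hlt
  refine ⟨E, hE, hfin, fun y hy hNy => ?_⟩
  have hb : BddBelow { u : ℝ | ∃ y : Y, y ∈ E ∧ N y = 1 ∧ u = N (x₀ + t • y) - 1 } := by
    by_contra hb
    rw [Real.sInf_of_not_bddBelow hb] at hs
    linarith
  have := csInf_le hb ⟨y, hy, hNy, rfl⟩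
  linarith

/-- Finite sums of far-out terms are uniformly bounded if the spreading model
has bounded sums. -/
lemma IsSpreadingModel.exists_norm_sum_le {X S : Type*} [NormedAddCommGroup X] [NormedSpace ℝ X]
    [NormedAddCommGroup S] [NormedSpace ℝ S] {x : ℕ → X} {e : ℕ → S}
    (hspread : IsSpreadingModel x e) {B : ℝ} (hB : ∀ k : ℕ, ‖∑ i : Fin k, e i‖ ≤ B) (k : ℕ) :
    ∃ ℓ : ℕ, ∀ s : Finset ℕ, s.card ≤ k → (∀ i ∈ s, ℓ ≤ i) → ‖∑ i ∈ s, x i‖ ≤ B + 1 := by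
  choose L hL using hspread 1 one_pos
  refine ⟨(Finset.range (k + 1)).sup L, fun s hs hsl => ?_⟩
  have hLs : L s.card ≤ (Finset.range (k + 1)).sup L :=
    Finset.le_sup (Finset.mem_range.2 (Nat.lt_succ_of_le hs))
  have h := hL s.card (s.orderEmbOfFin rfl) (s.orderEmbOfFin rfl).strictMono
    (fun i => hLs.trans (hsl _ (s.orderEmbOfFin_mem rfl i))) (fun _ => 1) (by simp)
  have hsum : ∑ i : Fin s.card, x (s.orderEmbOfFin rfl i) = ∑ i ∈ s, x i := by
    conv_rhs => rw [← Finset.map_orderEmbOfFin_univ s rfl, Finset.sum_map]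
    rfl
  simp only [one_smul, hsum] at h
  have := (abs_le.1 h).2
  linarith [hB s.card]

/-- Adding a weakly null perturbation of `N`-size at least `c` to a vector of `N`-size at most `C`
multiplies its `N`-size by a fixed factor, provided the modulus at `c / (2 * C)` is positive. -/
lemma eventually_mul_le_of_weaklyNull {Y : Type*} [NormedAddCommGroup Y] [NormedSpace ℝ Y]
    {N : Y → ℝ} (hsmul : ∀ (a : ℝ) (y : Y), N (a • y) = |a| * N y)
    (hadd : ∀ y z : Y, N (y + z) ≤ N y + N z) {b : ℝ} (hb : 0 < b) (hNb : ∀ y, N y ≤ b * ‖y‖)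
    {c C δ : ℝ} (hc : 0 < c) (hC : 0 < C) (hδ : 0 < δ)
    (hmod : ∀ x₀ : Y, N x₀ = 1 → ∃ E : Subspace ℝ Y, IsClosed (E : Set Y) ∧
      FiniteDimensional ℝ (Y ⧸ E) ∧ ∀ y ∈ E, N y = 1 → 1 + δ ≤ N (x₀ + (c / (2 * C)) • y))
    {z : Y} (hz : 0 < N z) (hzC : N z ≤ C) {u : ℕ → Y} (huc : ∀ n, c ≤ N (u n))
    (hu : ∀ φ : Y →L[ℝ] ℝ, Tendsto (fun n => φ (u n)) atTop (nhds 0)) :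
    ∀ᶠ n in atTop, N z * (1 + δ / 2) ≤ N (z + u n) := by
  set r := N z with hr
  set t := c / (2 * C) with ht
  have htpos : 0 < t := by positivity
  have hN1 : N (r⁻¹ • z) = 1 := by
    rw [hsmul, abs_of_pos (inv_pos.2 hz), ← hr, inv_mul_cancel₀ hz.ne']
  obtain ⟨E, hE, hfin, hEN⟩ := hmod _ hN1
  have hη : 0 < min t (δ / 2) / b := by positivity
  filter_upwards [eventually_exists_mem_norm_sub_lt E hE hfin (fun n => r⁻¹ • u n)
    (fun φ => by simpa using (hu φ).const_mul r⁻¹) _ hη] with n hn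
  obtain ⟨w, hwE, hw⟩ := hn
  have hd : N (r⁻¹ • u n - w) < min t (δ / 2) := by
    refine (hNb _).trans_lt ?_
    rwa [lt_div_iff₀ hb, mul_comm] at hw
  have hdt := hd.trans_le (min_le_left _ _)
  have hdδ := hd.trans_le (min_le_right _ _)
  have hv : 2 * t ≤ N (r⁻¹ • u n) := by
    rw [hsmul, abs_of_pos (inv_pos.2 hz), inv_mul_eq_div, ht, le_div_iff₀ hz]
    have : 2 * (c / (2 * C)) * r = c * (r / C) := by field_simp
    rw [this]
    have h1 : r / C ≤ 1 := (div_le_one hC).2 hzC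
    nlinarith [huc n]
  have hwt : t ≤ N w := by
    have := hadd (r⁻¹ • u n - w) w
    rw [sub_add_cancel] at this
    linarith
  have hwpos : 0 < N w := htpos.trans_le hwt
  have hNw1 : N ((N w)⁻¹ • w) = 1 := by
    rw [hsmul, abs_of_pos (inv_pos.2 hwpos), inv_mul_cancel₀ hwpos.ne']
  have h1 := hEN _ (E.smul_mem _ hwE) hNw1
  set θ := t * (N w)⁻¹ with hθ
  have hθ0 : 0 < θ := by positivity
  have hθ1 : θ ≤ 1 := by rw [hθ, ← div_eq_mul_inv]; exact (div_le_one hwpos).2 hwt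
  have hconv : N (r⁻¹ • z + t • (N w)⁻¹ • w) ≤ (1 - θ) + θ * N (r⁻¹ • z + w) := by
    have := hadd ((1 - θ) • (r⁻¹ • z)) (θ • (r⁻¹ • z + w))
    rw [hsmul (1 - θ), hsmul θ, hN1, abs_of_pos hθ0, abs_of_nonneg (by linarith)] at this
    convert this using 1
    · congr 1
      rw [hθ]
      module
    · ring
  have h2 : 1 + δ ≤ N (r⁻¹ • z + w) := by
    by_contra! hcon
    nlinarith
  have hneg : N (w - r⁻¹ • u n) = N (r⁻¹ • u n - w) := by
    have := hsmul (-1) (r⁻¹ • u n - w)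
    simpa using this
  have h3 : N (r⁻¹ • z + w) ≤ r⁻¹ * N (z + u n) + N (r⁻¹ • u n - w) := by
    have := hadd (r⁻¹ • (z + u n)) (w - r⁻¹ • u n)
    rw [hsmul, abs_of_pos (inv_pos.2 hz), hneg] at this
    convert this using 2
    module
  have h4 : 1 + δ / 2 ≤ r⁻¹ * N (z + u n) := by linarith
  rwa [inv_mul_eq_div, le_div_iff₀ hz, mul_comm] at h4

/-- Theorem 1.5: if `X` has a normalized weakly null sequence whose
spreading model is equivalent to the unit vector basis of `c₀`, and there is a weakly
sequentially continuous coarse map `X → Y` satisfying Property (*), then `Y` is not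
AUCable: every equivalent norm `N` on `Y` fails to be asymptotically uniformly convex. -/
theorem stmt2 {X Y : Type*} [NormedAddCommGroup X] [NormedSpace ℝ X] [CompleteSpace X]
    [NormedAddCommGroup Y] [NormedSpace ℝ Y] [CompleteSpace Y]
    (S : Type*) [NormedAddCommGroup S] [NormedSpace ℝ S] [CompleteSpace S]
    (x : ℕ → X) (e : ℕ → S)
    (hx_norm : ∀ n, ‖x n‖ = 1)
    (hx_wnull : ∀ φ : X →L[ℝ] ℝ, Tendsto (fun n => φ (x n)) atTop (nhds 0))
    (hspread : IsSpreadingModel x e)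
    (hc0 : ∃ A B : ℝ, 0 < A ∧ 0 < B ∧ ∀ (k : ℕ) (a : Fin k → ℝ),
      A * (⨆ i : Fin k, |a i|) ≤ ‖∑ i : Fin k, a i • e (i : ℕ)‖ ∧
      ‖∑ i : Fin k, a i • e (i : ℕ)‖ ≤ B * (⨆ i : Fin k, |a i|))
    (f : X → Y) (hwsc : WeakSeqCont f) (hcoarse : Coarse f) (hstar : PropertyStar f) :
    ∀ N : Y → ℝ,
      (∀ y : Y, N y = 0 ↔ y = 0) →
      (∀ (a : ℝ) (y : Y), N (a • y) = |a| * N y) →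
      (∀ y z : Y, N (y + z) ≤ N y + N z) →
      (∃ a b : ℝ, 0 < a ∧ 0 < b ∧ ∀ y : Y, a * ‖y‖ ≤ N y ∧ N y ≤ b * ‖y‖) →
      ∃ t : ℝ, 0 < t ∧
        sInf { r : ℝ | ∃ x₀ : Y, N x₀ = 1 ∧
          r = sSup { s : ℝ | ∃ E : Subspace ℝ Y, IsClosed (E : Set Y) ∧
            FiniteDimensional ℝ (Y ⧸ E) ∧
            s = sInf { u : ℝ | ∃ y : Y, y ∈ E ∧ N y = 1 ∧ u = N (x₀ + t • y) - 1 } } } ≤ 0 := by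
  intro N hN0 hsmul hadd hequiv
  obtain ⟨a, b, ha, hb, hab⟩ := hequiv
  obtain ⟨_, B, _, hB, hAB⟩ := hc0
  obtain ⟨α, β, d, hα, hαβ, hd, hstar⟩ := hstar
  have hsums : ∀ k : ℕ, ‖∑ i : Fin k, e i‖ ≤ B := fun k => by
    have h := (hAB k fun _ => 1).2
    simp only [one_smul, abs_one] at h
    exact h.trans (mul_le_of_le_one_right hB.le (Real.iSup_le (fun _ => le_rfl) zero_le_one))
  obtain ⟨D, hD⟩ := hcoarse (α * (B + 1)) (by positivity)
  have hinc : ∀ (w : X) (n : ℕ), a * d ≤ N (f (w + α • x n) - f w) := fun w n => by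
    have hnorm : ‖w + α • x n - w‖ = α := by
      rw [add_sub_cancel_left, norm_smul, hx_norm, mul_one, Real.norm_of_nonneg hα.le]
    have := hstar (w + α • x n) w hnorm.ge (hnorm.le.trans hαβ.le)
    exact (mul_le_mul_of_nonneg_left this ha.le).trans (hab _).1
  set C := b * (|D| + 1) with hC
  have hCpos : 0 < C := by positivity
  have hbound : ∀ w : X, ‖w‖ ≤ B + 1 → N (f (α • w) - f 0) ≤ C := fun w hw => by
    refine (hab _).2.trans (mul_le_mul_of_nonneg_left ?_ hb.le)
    refine (hD _ _ ?_).trans ((le_abs_self D).trans (by linarith))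
    rw [sub_zero, norm_smul, Real.norm_of_nonneg hα.le]
    exact mul_le_mul_of_nonneg_left hw hα.le
  have hc : 0 < a * d := by positivity
  refine ⟨a * d / (2 * C), by positivity, ?_⟩
  by_contra! hpos
  obtain ⟨δ, hδ, hmod⟩ := exists_subspace_of_modulus_pos N _ hpos
  obtain ⟨j₀, hj₀⟩ := pow_unbounded_of_one_lt (C / (a * d)) (show 1 < 1 + δ / 2 by linarith)
  obtain ⟨ℓ, hℓ⟩ := hspread.exists_norm_sum_le hsums (j₀ + 1)
  have grow : ∀ j ≤ j₀, ∃ s : Finset ℕ, s.card = j + 1 ∧ (∀ i ∈ s, ℓ ≤ i) ∧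
      a * d * (1 + δ / 2) ^ j ≤ N (f (α • ∑ i ∈ s, x i) - f 0) := by
    intro j
    induction j with
    | zero =>
      intro _
      refine ⟨{ℓ}, by simp, by simp, ?_⟩
      simpa using hinc 0 ℓ
    | succ j ih =>
      intro hj
      obtain ⟨s, hcard, hsℓ, hs⟩ := ih (by omega)
      set w := α • ∑ i ∈ s, x i with hw
      have hweak : ∀ ψ : Y →L[ℝ] ℝ,
          Tendsto (fun n => ψ (f (w + α • x n) - f w)) atTop (nhds 0) := fun ψ => by
        have := hwsc (fun n => w + α • x n) w (fun φ => by
          simpa using ((hx_wnull φ).const_mul α).const_add (φ w)) ψ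
        simpa using this.sub_const (ψ (f w))
      have hev := eventually_mul_le_of_weaklyNull hsmul hadd hb (fun y => (hab y).2) hc hCpos hδ
        hmod (lt_of_lt_of_le (by positivity) hs) (hbound _ (hℓ s (by omega) hsℓ)) (hinc w) hweak
      obtain ⟨n, hn, hnℓ, hns⟩ := (hev.and ((eventually_ge_atTop ℓ).and
        (eventually_gt_atTop (s.sup id)))).exists
      have hnmem : n ∉ s := fun h => absurd (Finset.le_sup (f := id) h) (not_le.2 hns)
      refine ⟨insert n s, by rw [Finset.card_insert_of_notMem hnmem, hcard], ?_, ?_⟩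
      · simpa [hnℓ] using hsℓ
      · rw [Finset.sum_insert hnmem, smul_add, ← hw, add_comm (α • x n) w, pow_succ, ← mul_assoc]
        refine (mul_le_mul_of_nonneg_right hs (by positivity)).trans (hn.trans_eq ?_)
        congr 1
        abel
  obtain ⟨s, hcard, hsℓ, hs⟩ := grow j₀ le_rfl
  rw [div_lt_iff₀ hc, mul_comm] at hj₀
  exact absurd (hs.trans (hbound _ (hℓ s hcard.le hsℓ))) (not_le.2 hj₀)
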